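/- Let p be a depth-zero, bifix-free pattern of dimensions a×c with a ≥ 2 and c ≥ 1. Then for all integers m ≥ n ≥ 0, the following identity holds in ℚ: s_p(n, m) = (m − n + 1) · Σ_{i ≥ 0, a·i ≤ n} (−1)^i · (1/(m − c·i + 1)) · C(n − (a−1)i, i) · C(m + n − (a+c−1)i, n − (a−1)i), where C(·,·) denotes the binomial coefficient (all arguments appearing are nonnegative in the stated range of summation). -/

import Mathlib

/-- A step of a lattice path: `u` (up) or `r` (right). -/
inductive Step : Type
  | u : Step
  | r : Step
deriving DecidableEq

/-- A word over the alphabet `{u, r}`. -/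
abbrev Word := List Step

/-- The number of letters `r` in a word. -/
def countR (w : Word) : ℕ := w.count Step.r

/-- The number of letters `u` in a word. -/
def countU (w : Word) : ℕ := w.count Step.u

/-- `dval q` = (number of `r`'s in `q`) - (number of `u`'s in `q`). -/
def dval (w : Word) : ℤ := (countR w : ℤ) - (countU w : ℤ)

/-- A pattern is depth-zero if every suffix `q` of it satisfies `dval q ≥ 0`. -/
def DepthZero (p : Word) : Prop := ∀ q : Word, q <:+ p → 0 ≤ dval q

/-- `o` is a bifix of `p`: a nonempty proper prefix of `p` that is also a (proper) suffix. -/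
def IsBifix (o p : Word) : Prop := o ≠ [] ∧ o ≠ p ∧ o <+: p ∧ o <:+ p

/-- A pattern is bifix-free if it has no bifix. -/
def BifixFree (p : Word) : Prop := ∀ o : Word, ¬ IsBifix o p

/-- `w` is a ballot path to the lattice point `(n, m)`: it has exactly `n` letters `r`
and `m` letters `u`, and every prefix has at least as many `u`'s as `r`'s. -/
def IsBallot (w : Word) (n m : ℤ) : Prop :=
  (countR w : ℤ) = n ∧ (countU w : ℤ) = m ∧
    ∀ t : Word, t <+: w → countR t ≤ countU t

/-- `w` avoids the pattern `p`: `p` does not occur in `w` as a contiguous substring. -/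
def Avoids (p w : Word) : Prop := ¬ p <:+: w

/-- `s p n m` is the number of ballot paths to `(n, m)` avoiding `p`
(`0` if `n < 0`, `m < 0`, or `m < n`, since then no such path exists). -/
noncomputable def s (p : Word) (n m : ℤ) : ℕ :=
  Set.ncard {w : Word | IsBallot w n m ∧ Avoids p w}

/-- The set of `p`-avoiding ballot paths to `(n, m)`, counted by `s p n m`. -/
def avoidingBallotPaths (p : Word) (n m : ℤ) : Set Word := {w | IsBallot w n m ∧ Avoids p w}

/-- The ballot paths to `(n, m)` that avoid `p` once their last letter is deleted. -/
def snocAvoidingBallotPaths (p : Word) (n m : ℤ) : Set Word :=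
  {w | IsBallot w n m ∧ ∃ v x, w = v ++ [x] ∧ Avoids p v}

lemma countR_append (v w : Word) : countR (v ++ w) = countR v + countR w := List.count_append

lemma countU_append (v w : Word) : countU (v ++ w) = countU v + countU w := List.count_append

lemma countR_add_countU (w : Word) : countR w + countU w = w.length := by
  induction w with
  | nil => rfl
  | cons x w ih => cases x <;> simp_all [countR, countU] <;> omega

lemma finite_setOf_isBallot (n m : ℤ) : {w : Word | IsBallot w n m}.Finite := by
  have : Finite Step := Finite.of_surjective (fun b : Bool => cond b Step.u Step.r)
    fun x => by cases x; exacts [⟨true, rfl⟩, ⟨false, rfl⟩]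
  refine (List.finite_length_eq Step (n + m).toNat).subset fun w hw => ?_
  have := countR_add_countU w
  have h1 := hw.1
  have h2 := hw.2.1
  simp only [Set.mem_ofPred_eq]
  omega

lemma finite_avoidingBallotPaths (p : Word) (n m : ℤ) : (avoidingBallotPaths p n m).Finite :=
  (finite_setOf_isBallot n m).subset fun _ h => h.1

lemma Avoids.antitone {p v w : Word} (h : Avoids p w) (hv : v <:+: w) : Avoids p v :=
  fun hp => h (hp.trans hv)

lemma IsBallot.of_append {v w : Word} {n m : ℤ} (h : IsBallot (v ++ w) n m) :
    IsBallot v (n - countR w) (m - countU w) := by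
  obtain ⟨h1, h2, h3⟩ := h
  rw [countR_append] at h1
  rw [countU_append] at h2
  exact ⟨by push_cast at h1; omega, by push_cast at h2; omega,
    fun t ht => h3 t (ht.trans (List.prefix_append v w))⟩

lemma IsBallot.append {v w : Word} {n m : ℤ} (h : IsBallot v (n - countR w) (m - countU w))
    (hw : DepthZero w) (hnm : n ≤ m) : IsBallot (v ++ w) n m := by
  obtain ⟨h1, h2, h3⟩ := h
  refine ⟨by rw [countR_append]; push_cast; omega, by rw [countU_append]; push_cast; omega,
    fun t ht => ?_⟩
  obtain ⟨q', ht⟩ := ht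
  rcases List.append_eq_append_iff.1 ht with ⟨k, rfl, -⟩ | ⟨q, rfl, rfl⟩
  · exact h3 t (List.prefix_append t k)
  · have := hw q' (List.suffix_append q q')
    simp only [dval, countR_append, countU_append] at *
    push_cast at *
    omega

lemma snocAvoidingBallotPaths_eq_union_snoc (p : Word) {n m : ℤ} (hnm : n ≤ m) :
    snocAvoidingBallotPaths p n m =
      (· ++ [Step.r]) '' avoidingBallotPaths p (n - 1) m ∪
        (· ++ [Step.u]) '' avoidingBallotPaths p n (m - 1) := by
  ext w
  constructor
  · rintro ⟨hw, v, x, rfl, hv⟩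
    have hb := hw.of_append
    cases x
    · right
      exact ⟨v, ⟨by simpa [countR, countU] using hb, hv⟩, rfl⟩
    · left
      exact ⟨v, ⟨by simpa [countR, countU] using hb, hv⟩, rfl⟩
  · have key : ∀ v x, IsBallot v (n - countR [x]) (m - countU [x]) → IsBallot (v ++ [x]) n m := by
      rintro v x ⟨h1, h2, h3⟩
      have e1 : (countR (v ++ [x]) : ℤ) = n := by rw [countR_append]; push_cast; omega
      have e2 : (countU (v ++ [x]) : ℤ) = m := by rw [countU_append]; push_cast; omega
      refine ⟨e1, e2, fun t ht => ?_⟩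
      rcases List.prefix_concat_iff.1 ht with rfl | ht
      · omega
      · exact h3 t ht
    rintro (⟨v, ⟨hb, hv⟩, rfl⟩ | ⟨v, ⟨hb, hv⟩, rfl⟩)
    · exact ⟨key v _ (by simpa [countR, countU] using hb), v, _, rfl, hv⟩
    · exact ⟨key v _ (by simpa [countR, countU] using hb), v, _, rfl, hv⟩

/-- If `p` is bifix-free and `v` avoids `p`, then the only occurrence of `p` in `v ++ p` is the
final one. -/
lemma Avoids.append_of_bifixFree {p q v : Word} {x : Step} (hbf : BifixFree p)
    (hp : p = q ++ [x]) (hv : Avoids p v) : Avoids p (v ++ q) := by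
  rintro ⟨l, k, h⟩
  rcases List.append_eq_append_iff.1 h with ⟨t, rfl, -⟩ | ⟨t, ht, rfl⟩
  · exact hv ⟨l, t, rfl⟩
  · rcases List.append_eq_append_iff.1 ht with ⟨j, rfl, hj⟩ | ⟨j, rfl, hj⟩
    · refine hbf t ⟨?_, ?_, ⟨k ++ [x], by rw [hp]; simp⟩, ⟨j, hj.symm⟩⟩
      · rintro rfl
        exact hv ⟨l, [], by simp [hj]⟩
      · rintro rfl
        have := congrArg List.length hp
        simp at this
    · have h1 := congrArg List.length hj
      have h2 := congrArg List.length hp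
      simp only [List.length_append, List.length_singleton] at h1 h2
      omega

lemma snocAvoidingBallotPaths_eq_union_append {p : Word} (hdz : DepthZero p) (hbf : BifixFree p)
    (hp0 : p ≠ []) {n m : ℤ} (hnm : n ≤ m) (hm : 0 < m) :
    snocAvoidingBallotPaths p n m =
      avoidingBallotPaths p n m ∪
        (· ++ p) '' avoidingBallotPaths p (n - countR p) (m - countU p) := by
  obtain ⟨q, x, hp⟩ := (List.eq_nil_or_concat' p).resolve_left hp0
  ext w
  constructor
  · rintro ⟨hw, v, y, rfl, hv⟩
    by_cases ha : Avoids p (v ++ [y])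
    · exact .inl ⟨hw, ha⟩
    · right
      obtain ⟨w', h⟩ := (List.infix_concat_iff.1 (not_not.1 ha)).resolve_right hv
      refine ⟨w', ⟨(h ▸ hw).of_append, hv.antitone ?_⟩, h⟩
      rw [hp, ← List.append_assoc] at h
      obtain ⟨rfl, -⟩ := List.append_inj' h rfl
      exact (List.prefix_append w' q).isInfix
  · rintro (⟨hw, ha⟩ | ⟨v, ⟨hb, hv⟩, rfl⟩)
    · rcases List.eq_nil_or_concat' w with rfl | ⟨v, y, rfl⟩
      · have := hw.2.1
        simp [countU] at this
        omega
      · exact ⟨hw, v, y, rfl, ha.antitone (List.prefix_append v [y]).isInfix⟩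
    · exact ⟨hb.append hdz hnm, v ++ q, x, by simp [hp], hv.append_of_bifixFree hbf hp⟩

/-- The recurrence counting `p`-avoiding ballot paths. -/
lemma s_sub_one_add_s_sub_one {p : Word} (hdz : DepthZero p) (hbf : BifixFree p)
    (hp0 : p ≠ []) {n m : ℤ} (hnm : n ≤ m) (hm : 0 < m) :
    s p (n - 1) m + s p n (m - 1) = s p n m + s p (n - countR p) (m - countU p) := by
  have h := (snocAvoidingBallotPaths_eq_union_snoc p hnm).symm.trans
    (snocAvoidingBallotPaths_eq_union_append hdz hbf hp0 hnm hm)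
  have hinj : ∀ q : Word, Function.Injective (· ++ q) := fun q => List.append_left_injective q
  have h' := congrArg Set.ncard h
  rw [Set.ncard_union_eq ?_ ((finite_avoidingBallotPaths p _ _).image _)
      ((finite_avoidingBallotPaths p _ _).image _),
    Set.ncard_union_eq ?_ (finite_avoidingBallotPaths p _ _)
      ((finite_avoidingBallotPaths p _ _).image _),
    Set.ncard_image_of_injective _ (hinj _), Set.ncard_image_of_injective _ (hinj _),
    Set.ncard_image_of_injective _ (hinj _)] at h'
  · exact h'
  · rw [Set.disjoint_left]
    rintro _ ⟨-, ha⟩ ⟨v, -, rfl⟩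
    exact ha (List.suffix_append v p).isInfix
  · rw [Set.disjoint_left]
    rintro _ ⟨v, -, rfl⟩ ⟨v', -, h⟩
    simp at h

lemma s_eq_zero_of_neg (p : Word) {n m : ℤ} (hn : n < 0) : s p n m = 0 := by
  refine (Set.ncard_eq_zero (finite_avoidingBallotPaths p n m)).2 ?_
  rw [Set.eq_empty_iff_forall_notMem]
  rintro w ⟨⟨h, -⟩, -⟩
  omega

lemma s_eq_zero_of_lt (p : Word) {n m : ℤ} (h : m < n) : s p n m = 0 := by
  refine (Set.ncard_eq_zero (finite_avoidingBallotPaths p n m)).2 ?_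
  rw [Set.eq_empty_iff_forall_notMem]
  rintro w ⟨⟨h1, h2, h3⟩, -⟩
  have := h3 w List.prefix_rfl
  omega

lemma s_zero_zero {p : Word} (hp0 : p ≠ []) : s p 0 0 = 1 := by
  rw [s, Set.ncard_eq_one]
  refine ⟨[], Set.eq_singleton_iff_unique_mem.2 ⟨⟨⟨rfl, rfl, fun t ht => ?_⟩, ?_⟩, ?_⟩⟩
  · rw [List.prefix_nil.1 ht]; rfl
  · exact fun h => hp0 (List.infix_nil.1 h)
  · rintro w ⟨⟨h1, h2, -⟩, -⟩
    have := countR_add_countU w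
    exact List.length_eq_zero_iff.1 (by omega)

/-- The absolute value of the `i`-th term of the explicit formula. -/
def ballotTerm (a c n m i : ℕ) : ℚ :=
  if a * i ≤ n then
    ((m : ℚ) - n + 1) * ((n - a * i + (m - c * i) + i).factorial : ℚ) /
      ((n - a * i).factorial * (m - c * i + 1).factorial * i.factorial)
  else 0

lemma ballotTerm_of_add {a c n m i x y : ℕ} (hn : n = a * i + x) (hm : m = c * i + y) :
    ballotTerm a c n m i = ((m : ℚ) - n + 1) * ((x + y + i).factorial : ℚ) /
      (x.factorial * (y + 1).factorial * i.factorial) := by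
  subst hn hm
  simp [ballotTerm]

lemma ballotTerm_eq_choose {a c n m i : ℕ} (ha : 1 ≤ a) (hca : c ≤ a) (hnm : n ≤ m)
    (hi : a * i ≤ n) :
    ballotTerm a c n m i = ((m : ℚ) - n + 1) * ((1 / ((m : ℚ) - c * i + 1)) *
      (Nat.choose (n - (a - 1) * i) i : ℚ) *
      (Nat.choose (m + n - (a + c - 1) * i) (n - (a - 1) * i) : ℚ)) := by
  obtain ⟨a, rfl⟩ := Nat.exists_eq_add_of_le' ha
  obtain ⟨x, rfl⟩ := Nat.exists_eq_add_of_le hi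
  obtain ⟨y, rfl⟩ := Nat.exists_eq_add_of_le ((Nat.mul_le_mul_right i hca).trans (hi.trans hnm))
  rw [ballotTerm_of_add rfl rfl]
  have e1 : (a + 1) * i + x - (a + 1 - 1) * i = i + x := by
    rw [Nat.add_sub_cancel, Nat.sub_eq_iff_eq_add] <;> nlinarith
  have e2 : c * i + y + ((a + 1) * i + x) - (a + 1 + c - 1) * i = (i + x) + y := by
    rw [show a + 1 + c - 1 = a + c by omega, Nat.sub_eq_iff_eq_add] <;> nlinarith
  rw [e1, e2, Nat.cast_add_choose, Nat.cast_add_choose,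
    show x + y + i = i + x + y by omega, Nat.factorial_succ y]
  have h1 : ((c * i + y : ℕ) : ℚ) - c * i + 1 = y + 1 := by push_cast; ring
  have h2 : (y : ℚ) + 1 ≠ 0 := by positivity
  have := Nat.factorial_ne_zero x
  have := Nat.factorial_ne_zero y
  have := Nat.factorial_ne_zero i
  have := Nat.factorial_ne_zero (i + x)
  rw [h1]
  push_cast
  field_simp

lemma ballotTerm_zero_left {a c m i : ℕ} (ha : 1 ≤ a) :
    ballotTerm a c 0 m i = if i = 0 then 1 else 0 := by
  rcases i with _ | i
  · have : (m : ℚ) + 1 ≠ 0 := by positivity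
    simp [ballotTerm, Nat.factorial_succ, Nat.factorial_ne_zero, this]
  · rw [ballotTerm, if_neg (by have := Nat.mul_pos ha i.succ_pos; simpa using this.ne'),
      if_neg (by omega)]

lemma ballotTerm_zero_succ (a c n m : ℕ) :
    ballotTerm a c (n + 1) (m + 1) 0 = ballotTerm a c n (m + 1) 0 + ballotTerm a c (n + 1) m 0 := by
  simp only [ballotTerm, Nat.mul_zero, Nat.zero_le, if_true, Nat.sub_zero, Nat.add_zero,
    Nat.factorial_zero, show n + 1 + (m + 1) = n + m + 1 + 1 by omega,
    show n + (m + 1) = n + m + 1 by omega, show n + 1 + m = n + m + 1 by omega,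
    Nat.factorial_succ]
  have := Nat.factorial_ne_zero n
  have := Nat.factorial_ne_zero m
  have : (n : ℚ) + 1 ≠ 0 := by positivity
  have : (m : ℚ) + 1 ≠ 0 := by positivity
  have : (m : ℚ) + 1 + 1 ≠ 0 := by positivity
  push_cast
  field_simp
  ring

lemma ballotTerm_succ {a c n m i : ℕ} (hca : c ≤ a) (hnm : n ≤ m) :
    ballotTerm a c (n + 1) (m + 1) (i + 1) =
      ballotTerm a c n (m + 1) (i + 1) + ballotTerm a c (n + 1) m (i + 1) +
        if a ≤ n + 1 then ballotTerm a c (n + 1 - a) (m + 1 - c) i else 0 := by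
  by_cases hi : a * (i + 1) ≤ n + 1
  swap
  · have h1 : ¬ a * (i + 1) ≤ n := by omega
    have h2 : ¬ (a ≤ n + 1 ∧ a * i ≤ n + 1 - a) := by rw [Nat.mul_succ] at hi; omega
    simp only [ballotTerm, if_neg hi, if_neg h1]
    split_ifs <;> simp_all
  obtain ⟨x, hx⟩ := Nat.exists_eq_add_of_le hi
  have hci := Nat.mul_le_mul_right (i + 1) hca
  obtain ⟨y, hy⟩ := Nat.exists_eq_add_of_le (show c * (i + 1) ≤ m + 1 by omega)
  have hx' : n + 1 - a = a * i + x := by rw [Nat.mul_succ] at hx; omega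
  have hy' : m + 1 - c = c * i + y := by rw [Nat.mul_succ] at hy; omega
  rw [if_pos (by rw [Nat.mul_succ] at hi; omega), ballotTerm_of_add hx hy,
    ballotTerm_of_add hx' hy', hx', hy']
  have hxq : (n : ℚ) = a * (i + 1) + x - 1 := by
    have := congrArg (Nat.cast : ℕ → ℚ) hx
    push_cast at this
    linarith
  have hyq : (m : ℚ) = c * (i + 1) + y - 1 := by
    have := congrArg (Nat.cast : ℕ → ℚ) hy
    push_cast at this
    linarith
  have := Nat.factorial_ne_zero x
  have := Nat.factorial_ne_zero y
  have := Nat.factorial_ne_zero i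
  have : (i : ℚ) + 1 ≠ 0 := by positivity
  have : (y : ℚ) + 1 ≠ 0 := by positivity
  have : (x + y + i).factorial ≠ 0 := Nat.factorial_ne_zero _
  have hA : ballotTerm a c n (m + 1) (i + 1) = ((m : ℚ) - n + 2) * x *
      ((x + y + i).factorial : ℚ) / (x.factorial * (y + 1).factorial * (i + 1).factorial) := by
    rcases x with _ | x
    · rw [ballotTerm, if_neg (by omega)]
      simp
    · rw [ballotTerm_of_add (x := x) (by omega) hy, show x + y + (i + 1) = x + 1 + y + i by omega,
        Nat.factorial_succ x]
      have := Nat.factorial_ne_zero x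
      have : (x : ℚ) + 1 ≠ 0 := by positivity
      push_cast
      field_simp
      ring
  have hB : ballotTerm a c (n + 1) m (i + 1) = ((m : ℚ) - n) * (y + 1) *
      ((x + y + i).factorial : ℚ) / (x.factorial * (y + 1).factorial * (i + 1).factorial) := by
    rcases y with _ | y
    · obtain rfl : n = m := by omega
      simp [ballotTerm]
    · rw [ballotTerm_of_add (y := y) hx (by omega), show x + y + (i + 1) = x + (y + 1) + i by omega,
        Nat.factorial_succ (y + 1)]
      have := Nat.factorial_ne_zero (y + 1)
      push_cast
      field_simp
      ring
  rw [hA, hB, show x + y + (i + 1) = x + y + i + 1 by omega, Nat.factorial_succ (x + y + i),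
    Nat.factorial_succ y, Nat.factorial_succ i, hxq, hyq]
  push_cast
  field_simp
  rw [hxq, hyq]
  ring

lemma s_eq_sum_ballotTerm {p : Word} {a c : ℕ} (hdz : DepthZero p) (hbf : BifixFree p)
    (hR : countR p = a) (hU : countU p = c) (ha : 1 ≤ a) (hca : c ≤ a) (n : ℕ) :
    ∀ m K : ℕ, n ≤ m → n < K →
      (s p n m : ℚ) = ∑ i ∈ Finset.range K, (-1 : ℚ) ^ i * ballotTerm a c n m i := by
  have hp0 : p ≠ [] := by
    rintro rfl
    simp [countR] at hR
    omega
  have hrec := fun n m hnm hm => s_sub_one_add_s_sub_one hdz hbf hp0 (n := n) (m := m) hnm hm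
  rw [hR, hU] at hrec
  induction n using Nat.strong_induction_on with
  | _ n ihn =>
  rcases n with _ | n
  · intro m K _ hK
    have hs : s p 0 m = 1 := by
      induction m with
      | zero => exact s_zero_zero hp0
      | succ m ih =>
        have := hrec 0 ((m + 1 : ℕ) : ℤ) (by omega) (by omega)
        rw [s_eq_zero_of_neg p (n := 0 - 1) (by omega), s_eq_zero_of_neg p (n := 0 - a) (by omega),
          show ((m + 1 : ℕ) : ℤ) - 1 = m by omega, ih (by omega)] at this
        omega
    have : 0 ∈ Finset.range K := Finset.mem_range.2 hK
    simp [ballotTerm_zero_left ha, hs, hK]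
  · intro m
    induction m with
    | zero => intro K h; omega
    | succ m ihm =>
      intro K hnm hK
      obtain ⟨K, rfl⟩ := Nat.exists_eq_add_of_lt (Nat.zero_lt_of_lt hK)
      rw [Nat.zero_add] at *
      have h := hrec ((n + 1 : ℕ) : ℤ) ((m + 1 : ℕ) : ℤ) (by omega) (by omega)
      rw [show ((n + 1 : ℕ) : ℤ) - 1 = n by omega, show ((m + 1 : ℕ) : ℤ) - 1 = m by omega] at h
      have h1 := ihn n (by omega) (m + 1) (K + 1) (by omega) (by omega)
      have h2 : (s p (n + 1 : ℕ) m : ℚ) =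
          ∑ i ∈ Finset.range (K + 1), (-1 : ℚ) ^ i * ballotTerm a c (n + 1) m i := by
        rcases Nat.lt_or_ge n m with hlt | hge
        · exact ihm (K + 1) hlt hK
        · obtain rfl : n = m := by omega
          rw [s_eq_zero_of_lt p (by omega), Finset.sum_eq_zero]
          · simp
          · simp [ballotTerm]
      have h3 : (s p ((n + 1 : ℕ) - a) ((m + 1 : ℕ) - c) : ℚ) = ∑ i ∈ Finset.range K, (-1 : ℚ) ^ i *
          if a ≤ n + 1 then ballotTerm a c (n + 1 - a) (m + 1 - c) i else 0 := by
        split_ifs with han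
        · rw [← ihn (n + 1 - a) (by omega) (m + 1 - c) K (by omega) (by omega),
            Nat.cast_sub han, Nat.cast_sub (by omega)]
        · rw [s_eq_zero_of_neg p (by omega)]
          simp
      have hq : (s p (n + 1 : ℕ) (m + 1 : ℕ) : ℚ) = s p n (m + 1 : ℕ) + s p (n + 1 : ℕ) m -
          s p ((n + 1 : ℕ) - a) ((m + 1 : ℕ) - c) := by
        rw [eq_sub_iff_add_eq]
        exact_mod_cast h.symm
      rw [hq, h1, h2, h3, Finset.sum_range_succ', Finset.sum_range_succ', Finset.sum_range_succ',
        ballotTerm_zero_succ, Finset.sum_congr rfl fun i _ =>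
          congrArg ((-1 : ℚ) ^ (i + 1) * ·) (ballotTerm_succ (i := i) hca (by omega : n ≤ m))]
      simp only [mul_add, Finset.sum_add_distrib, pow_succ, mul_neg, mul_one, neg_mul,
        Finset.sum_neg_distrib]
      ring

/-- Explicit formula for ballot paths avoiding a depth-zero, bifix-free pattern `p`
of dimensions `a × c` (`a ≥ 2`, `c ≥ 1`): for integers `m ≥ n ≥ 0`,
`s p n m = (m-n+1) ∑_{i ≥ 0, a i ≤ n} (-1)^i/(m-ci+1) C(n-(a-1)i, i) C(m+n-(a+c-1)i, n-(a-1)i)`. -/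
theorem ballot_avoiding_bifix_free_formula (p : Word) (a c : ℕ)
    (hdz : DepthZero p) (hbf : BifixFree p)
    (hdimR : countR p = a) (hdimU : countU p = c) (ha : 2 ≤ a) (hc : 1 ≤ c)
    (n m : ℕ) (hnm : n ≤ m) :
    (s p n m : ℚ) = ((m : ℚ) - n + 1) *
      ∑ i ∈ Finset.filter (fun i => a * i ≤ n) (Finset.range (n + 1)),
        (-1 : ℚ) ^ i * (1 / ((m : ℚ) - c * i + 1)) *
          (Nat.choose (n - (a - 1) * i) i : ℚ) *
          (Nat.choose (m + n - (a + c - 1) * i) (n - (a - 1) * i) : ℚ) := by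
  have hca : c ≤ a := by
    have := hdz p List.suffix_rfl
    rw [dval, hdimR, hdimU] at this
    omega
  rw [s_eq_sum_ballotTerm hdz hbf hdimR hdimU (by omega) hca n m (n + 1) hnm n.lt_succ_self,
    Finset.mul_sum, Finset.sum_filter]
  refine Finset.sum_congr rfl fun i _ => ?_
  split_ifs with hi
  · rw [ballotTerm_eq_choose (by omega) hca hnm hi]
    ring
  · rw [ballotTerm, if_neg hi, mul_zero]
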